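/- arXiv:2603.08612 — 6 statements merged into one kernel-verified Lean document; each statement's English description precedes it below -/
import Mathlib

section
/- Let the terms be T 1, …, T m (m ≥ 1), and for each i ∈ {1, …, m} define the assignment V_i : ι → Bool by V_i a = true if a ∈ T i, and V_i a = v a otherwise. Then the maximum of P(V) over all assignments V : ι → Bool that satisfy the DNF equals the maximum over i ∈ {1, …, m} of P(V_i). (In particular each V_i satisfies the DNF, so both maxima are over nonempty finite sets.) -/
/-- If `V` makes every element of `S` true, then overriding `v` by `true` on `S` gives an
assignment at least as likely as `V`. -/
theorem prod_likelihood_le_prod_override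
    {ι : Type*} [DecidableEq ι] (v : ι → Bool) (p : ι → ℝ)
    (hp : ∀ a, 0 ≤ p a ∧ p a ≤ 1 / 2) (I S : Finset ι) (V : ι → Bool)
    (hV : ∀ a ∈ S, V a = true) :
    ∏ a ∈ I, (if V a = v a then 1 - p a else p a) ≤
      ∏ a ∈ I, (if (if a ∈ S then true else v a) = v a then 1 - p a else p a) := by
  refine Finset.prod_le_prod (fun a _ => ?_) (fun a _ => ?_)
  · obtain ⟨h0, h1⟩ := hp a
    split_ifs <;> linarith
  · obtain ⟨h0, h1⟩ := hp a
    by_cases ha : a ∈ S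
    · simp [ha, hV a ha]
    · simp only [ha, if_false, if_true]
      split_ifs <;> linarith

/-- Worst-case-world lemma for positive DNFs (Lemma 4.2 / Prop 4.1).
The maximum likelihood over assignments satisfying the DNF equals the maximum
over the canonical worlds `V_i` that set exactly the variables of term `i` to
`true` and follow the reference labeling `v` elsewhere. -/
theorem dnf_worst_case_world
    {ι : Type*} [Fintype ι] [DecidableEq ι]
    (v : ι → Bool) (p : ι → ℝ) (hp : ∀ a, 0 ≤ p a ∧ p a ≤ 1 / 2)
    (I : Finset ι) (m : ℕ) (hm : 1 ≤ m) (T : Fin m → Finset ι) :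
    sSup {x : ℝ | ∃ V : ι → Bool,
        (∃ i : Fin m, ∀ a ∈ T i, V a = true) ∧
        x = ∏ a ∈ I, (if V a = v a then 1 - p a else p a)}
      = sSup {x : ℝ | ∃ i : Fin m,
        x = ∏ a ∈ I,
          (if (fun b => if b ∈ T i then true else v b) a = v a
            then 1 - p a else p a)} := by
  have hfin : {x : ℝ | ∃ i : Fin m,
      x = ∏ a ∈ I,
        (if (fun b => if b ∈ T i then true else v b) a = v a
          then 1 - p a else p a)}.Finite :=
    (Set.finite_range fun i : Fin m => ∏ a ∈ I,
      (if (fun b => if b ∈ T i then true else v b) a = v a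
        then 1 - p a else p a)).subset fun _ ⟨i, hi⟩ => ⟨i, hi.symm⟩
  have hfin' : {x : ℝ | ∃ V : ι → Bool,
      (∃ i : Fin m, ∀ a ∈ T i, V a = true) ∧
      x = ∏ a ∈ I, (if V a = v a then 1 - p a else p a)}.Finite :=
    (Set.finite_range fun V : ι → Bool => ∏ a ∈ I,
      (if V a = v a then 1 - p a else p a)).subset fun _ ⟨V, _, hx⟩ => ⟨V, hx.symm⟩
  apply le_antisymm
  · refine csSup_le ⟨_, fun _ => true, ⟨⟨0, hm⟩, fun _ _ => rfl⟩, rfl⟩ ?_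
    rintro x ⟨V, ⟨i, hi⟩, rfl⟩
    exact (prod_likelihood_le_prod_override v p hp I (T i) V hi).trans
      (le_csSup hfin.bddAbove ⟨i, rfl⟩)
  · refine csSup_le_csSup hfin'.bddAbove ⟨_, ⟨0, hm⟩, rfl⟩ ?_
    rintro x ⟨i, rfl⟩
    exact ⟨fun b => if b ∈ T i then true else v b, ⟨i, fun a ha => if_pos ha⟩, rfl⟩
end

section
/- Let the terms be T 1, …, T m, fix i₀ ∈ {1, …, m}, and define V_{i₀} : ι → Bool by V_{i₀} a = true if a ∈ T i₀, and V_{i₀} a = v a otherwise. If an assignment V : ι → Bool satisfies term i₀, i.e. V a = true for all a ∈ T i₀, then P(V) ≤ P(V_{i₀}). -/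
/-- Any world satisfying term `i₀` of a positive DNF is no more
likely than the canonical world that sets exactly the variables of term `i₀`
to `true` and keeps the reference labeling `v` elsewhere. -/
theorem dnf_term_world_le
    {ι : Type*} [Fintype ι] [DecidableEq ι]
    (v : ι → Bool) (p : ι → ℝ) (hp : ∀ a, 0 ≤ p a ∧ p a ≤ 1 / 2)
    (I : Finset ι) (m : ℕ) (T : Fin m → Finset ι) (i₀ : Fin m)
    (V : ι → Bool) (hV : ∀ a ∈ T i₀, V a = true) :
    (∏ a ∈ I, (if V a = v a then 1 - p a else p a))
      ≤ ∏ a ∈ I,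
          (if (fun b => if b ∈ T i₀ then true else v b) a = v a
            then 1 - p a else p a) := by
  refine Finset.prod_le_prod (fun a _ => ?_) (fun a _ => ?_)
  · obtain ⟨h0, h1⟩ := hp a
    split_ifs <;> linarith
  · obtain ⟨h0, h1⟩ := hp a
    by_cases ha : a ∈ T i₀
    · simp [ha, hV a ha]
    · simp only [ha, if_false, if_true]
      split_ifs <;> linarith
end

section
/- Let the clauses be C 1, …, C m (m ≥ 1), and for each i ∈ {1, …, m} define the assignment W_i : ι → Bool by W_i a = false if a ∈ C i, and W_i a = v a otherwise. Then the maximum of P(V) over all assignments V : ι → Bool that do NOT satisfy the CNF equals the maximum over i ∈ {1, …, m} of P(W_i). (In particular each W_i falsifies clause i and hence does not satisfy the CNF, so both maxima are over nonempty finite sets.) -/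
/-- Resetting every variable outside a set on which an assignment is `false` to the reference
labeling does not decrease the likelihood. -/
theorem likelihood_le_of_forall_eq_false
    {ι : Type*} [DecidableEq ι] {v V : ι → Bool} {p : ι → ℝ}
    (hp : ∀ a, 0 ≤ p a ∧ p a ≤ 1 / 2) (I : Finset ι) {c : Finset ι}
    (hV : ∀ a ∈ c, V a = false) :
    ∏ a ∈ I, (if V a = v a then 1 - p a else p a) ≤
      ∏ a ∈ I, (if (if a ∈ c then false else v a) = v a then 1 - p a else p a) := by
  refine Finset.prod_le_prod (fun a _ => ?_) (fun a _ => ?_)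
  · obtain ⟨h₀, h₁⟩ := hp a
    split_ifs <;> linarith
  · obtain ⟨h₀, h₁⟩ := hp a
    by_cases ha : a ∈ c
    · simp [ha, hV a ha]
    · simp only [ha, if_false, if_true]
      split_ifs <;> linarith


/-- CNF dual of the worst-case-world lemma (Prop 4.3).
The maximum likelihood over assignments not satisfying the positive CNF equals
the maximum over the canonical worlds `W_i` that set exactly the variables of
clause `i` to `false` and follow the reference labeling `v` elsewhere. -/
theorem cnf_worst_case_world
    {ι : Type*} [Fintype ι] [DecidableEq ι]
    (v : ι → Bool) (p : ι → ℝ) (hp : ∀ a, 0 ≤ p a ∧ p a ≤ 1 / 2)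
    (I : Finset ι) (m : ℕ) (hm : 1 ≤ m) (C : Fin m → Finset ι) :
    sSup {x : ℝ | ∃ V : ι → Bool,
        ¬ (∀ i : Fin m, ∃ a ∈ C i, V a = true) ∧
        x = ∏ a ∈ I, (if V a = v a then 1 - p a else p a)}
      = sSup {x : ℝ | ∃ i : Fin m,
        x = ∏ a ∈ I,
          (if (fun b => if b ∈ C i then false else v b) a = v a
            then 1 - p a else p a)} := by
  refine csSup_eq_csSup_of_forall_exists_le ?_ ?_
  · rintro _ ⟨V, hV, rfl⟩
    push Not at hV
    obtain ⟨i, hi⟩ := hV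
    exact ⟨_, ⟨i, rfl⟩,
      likelihood_le_of_forall_eq_false hp I fun a ha => Bool.eq_false_of_not_eq_true (hi a ha)⟩
  · rintro _ ⟨i, rfl⟩
    refine ⟨_, ⟨fun b => if b ∈ C i then false else v b, fun h => ?_, rfl⟩, le_rfl⟩
    obtain ⟨a, ha, hW⟩ := h i
    simp [ha] at hW
end

section
/- Let the clauses be C 1, …, C m, fix i₀ ∈ {1, …, m}, and define W_{i₀} : ι → Bool by W_{i₀} a = false if a ∈ C i₀, and W_{i₀} a = v a otherwise. If an assignment V : ι → Bool falsifies clause i₀, i.e. V a = false for all a ∈ C i₀, then P(V) ≤ P(W_{i₀}). -/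
/-- Any world falsifying clause `i₀` of a positive CNF is no more
likely than the canonical world that sets exactly the variables of clause `i₀`
to `false` and keeps the reference labeling `v` elsewhere. -/
theorem cnf_clause_world_le
    {ι : Type*} [Fintype ι] [DecidableEq ι]
    (v : ι → Bool) (p : ι → ℝ) (hp : ∀ a, 0 ≤ p a ∧ p a ≤ 1 / 2)
    (I : Finset ι) (m : ℕ) (C : Fin m → Finset ι) (i₀ : Fin m)
    (V : ι → Bool) (hV : ∀ a ∈ C i₀, V a = false) :
    (∏ a ∈ I, (if V a = v a then 1 - p a else p a))
      ≤ ∏ a ∈ I,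
          (if (fun b => if b ∈ C i₀ then false else v b) a = v a
            then 1 - p a else p a) := by
  refine Finset.prod_le_prod (fun a _ => ?_) (fun a _ => ?_)
  · obtain ⟨h₀, h₁⟩ := hp a
    split_ifs <;> linarith
  · obtain ⟨h₀, h₁⟩ := hp a
    by_cases hC : a ∈ C i₀
    · simp [hC, hV a hC]
    · simp only [hC, if_false, if_true]
      split_ifs <;> linarith
end

section
/- The maximum, over all assignments V : α → Bool such that no edge of G has both endpoints assigned true, of the product ∏_{w ∈ α} (0.7 if V w = true, 0.3 if V w = false), equals 0.7^{α(G)} · 0.3^{n − α(G)}, where n = |α| and α(G) is the independence number of G (the maximum cardinality of an independent set of G). -/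
theorem Fintype.prod_ite_const {α M : Type*} [Fintype α] [CommMonoid M] (p : α → Prop)
    [DecidablePred p] (a b : M) :
    ∏ w : α, (if p w then a else b) =
      a ^ (Finset.univ.filter p).card *
        b ^ (Fintype.card α - (Finset.univ.filter p).card) := by
  classical
  rw [Finset.prod_ite, Finset.prod_const, Finset.prod_const, Finset.filter_not,
    ← Finset.compl_eq_univ_sdiff, Finset.card_compl]

theorem pow_mul_pow_sub_le_of_le {R : Type*} [CommSemiring R] [PartialOrder R]
    [IsOrderedRing R] {a b : R} (hb : 0 ≤ b) (hba : b ≤ a) {m k n : ℕ} (hmk : m ≤ k)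
    (hkn : k ≤ n) : a ^ m * b ^ (n - m) ≤ a ^ k * b ^ (n - k) := by
  have ha : 0 ≤ a := hb.trans hba
  calc a ^ m * b ^ (n - m) = a ^ m * b ^ (k - m) * b ^ (n - k) := by
        rw [mul_assoc, ← pow_add]
        congr 2
        omega
    _ ≤ a ^ m * a ^ (k - m) * b ^ (n - k) := by gcongr
    _ = a ^ k * b ^ (n - k) := by rw [← pow_add, Nat.add_sub_cancel' hmk]

/-- In the NP-hardness reduction (Prop 4.2), the maximum
likelihood over assignments setting no edge's endpoints both to `true`
equals `0.7 ^ α(G) * 0.3 ^ (n - α(G))`, where `α(G)` is the independence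
number of `G` and `n = |α|`. -/
theorem max_likelihood_eq_indep_number
    {α : Type*} [Fintype α] [Nonempty α] (G : SimpleGraph α)
    (k : ℕ)
    (hk_mem : ∃ S : Finset α, (∀ u ∈ S, ∀ w ∈ S, ¬ G.Adj u w) ∧ S.card = k)
    (hk_max : ∀ S : Finset α, (∀ u ∈ S, ∀ w ∈ S, ¬ G.Adj u w) → S.card ≤ k) :
    sSup {x : ℝ | ∃ V : α → Bool,
        (¬ ∃ u w, G.Adj u w ∧ V u = true ∧ V w = true) ∧
        x = ∏ w : α, (if V w = true then (0.7 : ℝ) else 0.3)}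
      = 0.7 ^ k * 0.3 ^ (Fintype.card α - k) := by
  classical
  obtain ⟨S, hS, rfl⟩ := hk_mem
  refine IsGreatest.csSup_eq ⟨⟨fun w => decide (w ∈ S), ?_, ?_⟩, ?_⟩
  · rintro ⟨u, w, huw, hu, hw⟩
    exact hS u (of_decide_eq_true hu) w (of_decide_eq_true hw) huw
  · rw [Fintype.prod_ite_const]
    simp
  · rintro x ⟨V, hV, rfl⟩
    rw [Fintype.prod_ite_const]
    refine pow_mul_pow_sub_le_of_le (by norm_num) (by norm_num) (hk_max _ ?_) S.card_le_univ
    intro u hu w hw huw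
    exact hV ⟨u, w, huw, (Finset.mem_filter.mp hu).2, (Finset.mem_filter.mp hw).2⟩
end

section
/- For every nonempty finite set A of assignments V : ι → Bool, the maximum over V ∈ A of P(V) equals exp(β + ξ), where ξ is the maximum over V ∈ A of ∑_{a ∈ ι} c a · r_V a; here r_V a = 1 if V a = true and 0 otherwise, c a = ln(1 − p a) − ln(p a) if v a = true and c a = ln(p a) − ln(1 − p a) if v a = false, and β = ∑_{a ∈ ι} (ln(p a) if v a = true else ln(1 − p a)). -/
/-- Correctness of Algorithm 2 (Prop 4.4): the maximum
likelihood over a nonempty finite set `A` of assignments equals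
`exp (β + ξ)` where `ξ` is the maximum of the linear objective `cᵀ · r_V`
over `A`. -/
theorem max_likelihood_eq_exp_ilp
    {ι : Type*} [Fintype ι]
    (v : ι → Bool) (p : ι → ℝ) (hp : ∀ a, 0 < p a ∧ p a < 1)
    (A : Finset (ι → Bool)) (hA : A.Nonempty) :
    A.sup' hA (fun V => ∏ a : ι, (if V a = v a then 1 - p a else p a))
      = Real.exp
          ((∑ a : ι, (if v a = true then Real.log (p a) else Real.log (1 - p a)))
            + A.sup' hA (fun V => ∑ a : ι,
                (if v a = true then Real.log (1 - p a) - Real.log (p a)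
                  else Real.log (p a) - Real.log (1 - p a))
                * (if V a = true then (1 : ℝ) else 0))) := by
  set β := ∑ a : ι, (if v a = true then Real.log (p a) else Real.log (1 - p a))
  have hmono : Monotone fun x : ℝ => Real.exp (β + x) := fun x y hxy => by
    dsimp only
    gcongr
  rw [Finset.apply_sup'_eq_sup'_comp hA (fun x : ℝ => Real.exp (β + x)) hmono.map_sup]
  refine Finset.sup'_congr hA rfl fun V _ => ?_
  simp only [Function.comp_apply, β]
  rw [← Finset.sum_add_distrib, Real.exp_sum]
  refine Finset.prod_congr rfl fun a _ => ?_
  obtain ⟨h0, h1⟩ := hp a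
  have h2 : 0 < 1 - p a := sub_pos.mpr h1
  cases v a <;> cases V a <;> simp [Real.exp_log h0, Real.exp_log h2]
end
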